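/- arXiv:2304.08329 — 4 statements merged into one kernel-verified Lean document; each statement's English description precedes it below -/
import Mathlib

section
/- Let k be a field of characteristic p > 0 and let q = p^s be a power of p with s ≥ 1. Let n ≥ 1 and m ≥ 0 be integers, let f ∈ k[X] be a polynomial all of whose coefficients c satisfy c^q = c, and let ξ, ζ, α, β be nonzero elements of k such that f(ξ·X) = ξ^m · f(X) (an identity of polynomials in k[X]), ζ^n = ξ^m, α^(q−1) = ξ^(−1), and β^(q−1) = ζ^(−1). Then every coefficient c of the polynomial f₁(X) := β^n · f(α^(−1)·X) ∈ k[X] satisfies c^q = c. -/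
open Polynomial

/-- Example 2.7 of the paper: the tame twist of a superelliptic model `y^n = f(x)`
defined over `F_q` is again defined over `F_q`. -/
theorem tame_twist_rational {k : Type*} [Field k] (p : ℕ) (hp : p.Prime) (hchar : CharP k p)
    (s : ℕ) (hs : 1 ≤ s) (q : ℕ) (hq : q = p ^ s)
    (n : ℕ) (hn : 1 ≤ n) (m : ℕ)
    (f : Polynomial k) (hf : ∀ i, (f.coeff i) ^ q = f.coeff i)
    (ξ ζ α β : k) (hξ : ξ ≠ 0) (hζ : ζ ≠ 0) (hα : α ≠ 0) (hβ : β ≠ 0)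
    (hfξ : f.comp (C ξ * X) = C (ξ ^ m) * f)
    (hζn : ζ ^ n = ξ ^ m)
    (hαq : α ^ (q - 1) = ξ⁻¹) (hβq : β ^ (q - 1) = ζ⁻¹) :
    ∀ i, ((C (β ^ n) * f.comp (C α⁻¹ * X)).coeff i) ^ q
      = (C (β ^ n) * f.comp (C α⁻¹ * X)).coeff i := by
  intro i
  have hq1 : q - 1 + 1 = q := Nat.sub_add_cancel (hq ▸ Nat.one_le_pow s p hp.pos)
  have hα' : α ^ q = ξ⁻¹ * α := by rw [← hq1, pow_succ, hαq]
  have hβ' : β ^ q = ζ⁻¹ * β := by rw [← hq1, pow_succ, hβq]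
  have hcoeff := congrArg (fun g => g.coeff i) hfξ
  simp only [comp_C_mul_X_coeff, coeff_C_mul] at hcoeff ⊢
  rw [mul_pow, mul_pow, hf i, pow_right_comm β, pow_right_comm α⁻¹, inv_pow α q, hα', hβ',
    mul_inv, inv_inv, mul_pow, mul_pow, inv_pow, hζn]
  have hm : ξ ^ m ≠ 0 := pow_ne_zero m hξ
  calc (ξ ^ m)⁻¹ * β ^ n * (f.coeff i * (ξ ^ i * α⁻¹ ^ i))
      = (ξ ^ m)⁻¹ * β ^ n * α⁻¹ ^ i * (f.coeff i * ξ ^ i) := by ring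
    _ = (ξ ^ m)⁻¹ * β ^ n * α⁻¹ ^ i * (ξ ^ m * f.coeff i) := by rw [hcoeff]
    _ = (ξ ^ m)⁻¹ * ξ ^ m * (β ^ n * (f.coeff i * α⁻¹ ^ i)) := by ring
    _ = β ^ n * (f.coeff i * α⁻¹ ^ i) := by rw [inv_mul_cancel₀ hm, one_mul]
end

section
/- Let k be a field of characteristic p > 0 and let q = p^s be a power of p with s ≥ 1. Let n ≥ 1 be an integer, let f ∈ k[X] be a polynomial all of whose coefficients c satisfy c^q = c, and let ξ, ζ, α ∈ k and β ∈ k nonzero be such that f(X + ξ) = f(X) (an identity of polynomials in k[X]), ζ^n = 1, α^q − α + ξ = 0, and β^(q−1) = ζ^(−1). Then every coefficient c of the polynomial f₁(X) := β^n · f(X − α) ∈ k[X] satisfies c^q = c. -/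
open Polynomial

/-- Example 2.8 of the paper: the wild twist of a superelliptic model `y^n = f(x)`
defined over `F_q` is again defined over `F_q`. -/
theorem wild_twist_rational {k : Type*} [Field k] (p : ℕ) (hp : p.Prime) (hchar : CharP k p)
    (s : ℕ) (hs : 1 ≤ s) (q : ℕ) (hq : q = p ^ s)
    (n : ℕ) (hn : 1 ≤ n)
    (f : Polynomial k) (hf : ∀ i, (f.coeff i) ^ q = f.coeff i)
    (ξ ζ α β : k) (hβ : β ≠ 0)
    (hfξ : f.comp (X + C ξ) = f)
    (hζn : ζ ^ n = 1)
    (hα : α ^ q - α + ξ = 0) (hβq : β ^ (q - 1) = ζ⁻¹) :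
    ∀ i, ((C (β ^ n) * f.comp (X - C α)).coeff i) ^ q
      = (C (β ^ n) * f.comp (X - C α)).coeff i := by
  have : Fact p.Prime := ⟨hp⟩
  have hφ : ∀ x : k, iterateFrobenius k p s x = x ^ q := fun x => by
    rw [iterateFrobenius_def, hq]
  have hq0 : q ≠ 0 := hq ▸ pow_ne_zero s hp.ne_zero
  have hfφ : f.map (iterateFrobenius k p s) = f := by
    ext i
    rw [coeff_map, hφ, hf]
  have hβφ : iterateFrobenius k p s (β ^ n) = β ^ n := by
    rw [hφ, ← pow_mul, mul_comm, pow_mul, ← mul_pow_sub_one hq0 β, hβq, mul_pow, inv_pow, hζn,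
      inv_one, mul_one]
  have hαφ : iterateFrobenius k p s α = α - ξ := by
    rw [hφ]
    linear_combination hα
  have hmap : (C (β ^ n) * f.comp (X - C α)).map (iterateFrobenius k p s) =
      C (β ^ n) * f.comp (X - C α) := by
    rw [Polynomial.map_mul, map_C, hβφ, map_comp, hfφ, Polynomial.map_sub, map_X, map_C, hαφ]
    conv_rhs => rw [← hfξ, comp_assoc]
    congr 2
    simp only [add_comp, X_comp, C_comp, C_sub]
    ring
  intro i
  rw [← hφ, ← coeff_map, hmap]
end

section
/- Let V be a finite-dimensional complex vector space and let A, B : V → V be linear automorphisms. Let a be a natural number coprime to 9 whose residue class in the unit group (ℤ/9ℤ)ˣ has multiplicative order 6, and assume A ∘ B ∘ A⁻¹ = B^a and that the characteristic polynomial of B equals the 9th cyclotomic polynomial Φ₉(X) = X⁶ + X³ + 1. Then the only linear subspaces W ⊆ V satisfying A(W) ⊆ W and B(W) ⊆ W are W = 0 and W = V. In other words, the 6-dimensional representation of the group generated by A and B on V is irreducible. -/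
open Polynomial

/-- If `B ^ n = 1`, `A B = B ^ a A` and `a ^ m ≡ 1 [MOD n]`, then `A ^ i` sends an eigenvector
of `B` for `ζ` to an eigenvector for `ζ ^ (a ^ ((m - 1) * i))`. -/
lemma Module.End.apply_pow_eigenvector_of_conj_pow {K V : Type*} [CommRing K] [AddCommGroup V]
    [Module K V] {A B : Module.End K V} {a m n : ℕ} (hm : 1 ≤ m)
    (hAB : SemiconjBy A B (B ^ a)) (hB : B ^ n = 1) (ha : a ^ m ≡ 1 [MOD n])
    {ζ : K} {v : V} (hv : B v = ζ • v) (i : ℕ) :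
    B ((A ^ i) v) = ζ ^ (a ^ ((m - 1) * i)) • (A ^ i) v := by
  have hsemi (i : ℕ) : SemiconjBy (A ^ i) B (B ^ a ^ i) := by
    induction i with
    | zero => simp
    | succ i ih =>
      rw [pow_succ', pow_succ', pow_mul]
      exact (hAB.pow_right _).mul_left ih
  have hpow : B ^ (a ^ i * a ^ ((m - 1) * i)) = B := by
    have h : a ^ i * a ^ ((m - 1) * i) ≡ 1 [MOD n] := by
      have he : i + (m - 1) * i = m * i := by
        obtain ⟨k, rfl⟩ := Nat.exists_eq_add_of_le' hm
        simp only [Nat.add_sub_cancel]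
        ring
      rw [← pow_add, he, pow_mul]
      simpa using ha.pow i
    rw [pow_eq_pow_mod _ hB, h, ← pow_eq_pow_mod _ hB, pow_one]
  have hvk (k : ℕ) : (B ^ k) v = ζ ^ k • v := by
    induction k with
    | zero => simp
    | succ k ih => simp [pow_succ, hv, ih, smul_smul, mul_comm]
  have key := LinearMap.congr_fun ((hsemi i).pow_right (a ^ ((m - 1) * i))).eq v
  rw [← pow_mul, hpow, Module.End.mul_apply, Module.End.mul_apply, hvk, map_smul] at key
  exact key.symm

/-- The irreducibility argument of Example 3.2 of the paper: if `A B` are automorphisms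
of a finite-dimensional complex vector space with `A B A⁻¹ = B^a`, where `a` has order 6
in `(ℤ/9ℤ)ˣ`, and the characteristic polynomial of `B` is the 9th cyclotomic polynomial,
then the representation of the group generated by `A` and `B` is irreducible. -/
theorem irreducible_of_conj_pow {V : Type*} [AddCommGroup V] [Module ℂ V]
    [FiniteDimensional ℂ V] (A B : V ≃ₗ[ℂ] V)
    (a : ℕ) (ha : Nat.Coprime a 9) (horder : orderOf (ZMod.unitOfCoprime a ha) = 6)
    (hconj : A * B * A⁻¹ = B ^ a)
    (hchar : LinearMap.charpoly (B : V →ₗ[ℂ] V) = cyclotomic 9 ℂ) :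
    ∀ W : Submodule ℂ V, (∀ x ∈ W, A x ∈ W) → (∀ x ∈ W, B x ∈ W) → W = ⊥ ∨ W = ⊤ := by
  intro W hA hB
  refine or_iff_not_imp_left.mpr fun hW => ?_
  have hdim : Module.finrank ℂ V = 6 := by
    rw [← LinearMap.charpoly_natDegree (B : V →ₗ[ℂ] V), hchar, natDegree_cyclotomic]
    decide
  have hB9 : (B : Module.End ℂ V) ^ 9 = 1 := by
    have h := aeval_eq_zero_of_dvd_aeval_eq_zero (cyclotomic.dvd_X_pow_sub_one 9 ℂ)
      (hchar ▸ LinearMap.aeval_self_charpoly (B : V →ₗ[ℂ] V))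
    simpa [sub_eq_zero] using h
  have hAB : SemiconjBy (A : Module.End ℂ V) B ((B : Module.End ℂ V) ^ a) := by
    have h : SemiconjBy A B (B ^ a) := mul_inv_eq_iff_eq_mul.mp hconj
    have h' := h.map (LinearEquiv.automorphismGroup.toLinearMapMonoidHom (R := ℂ) (M := V))
    rwa [map_pow] at h'
  have hmod {i j : ℕ} (h : a ^ i ≡ a ^ j [MOD 9]) : i ≡ j [MOD 6] := by
    rw [← horder, ← pow_eq_pow_iff_modEq, Units.ext_iff]
    simpa using (ZMod.natCast_eq_natCast_iff _ _ 9).mpr h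
  have ha6 : a ^ 6 ≡ 1 [MOD 9] := by
    simpa [show Nat.totient 9 = 6 by decide] using Nat.ModEq.pow_totient ha
  have : Nontrivial W := Submodule.nontrivial_iff_ne_bot.mpr hW
  obtain ⟨ζ, hζ⟩ := Module.End.exists_eigenvalue ((B : V →ₗ[ℂ] V).restrict hB)
  obtain ⟨w, hw⟩ := hζ.exists_hasEigenvector
  have hv : (B : Module.End ℂ V) w = ζ • (w : V) := congrArg Subtype.val hw.apply_eq_smul
  have hv0 : (w : V) ≠ 0 := by simpa using hw.2
  have hprim : IsPrimitiveRoot ζ 9 := by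
    have hroot : (LinearMap.charpoly (B : V →ₗ[ℂ] V)).IsRoot ζ :=
      Module.End.hasEigenvalue_iff_isRoot_charpoly _ _ |>.mp
        (Module.End.hasEigenvalue_of_hasEigenvector
          ⟨Module.End.mem_eigenspace_iff.mpr hv, hv0⟩)
    rwa [hchar, isRoot_cyclotomic_iff] at hroot
  have hpowW (i : ℕ) : ((A : Module.End ℂ V) ^ i) w ∈ W := by
    induction i with
    | zero => simp
    | succ i ih =>
      rw [pow_succ', Module.End.mul_apply]
      exact hA _ ih
  have hpow0 (i : ℕ) : ((A : Module.End ℂ V) ^ i) w ≠ 0 := by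
    induction i with
    | zero => simpa using hv0
    | succ i ih =>
      rw [pow_succ', Module.End.mul_apply]
      exact (LinearEquiv.map_ne_zero_iff A).mpr ih
  have hinj : Function.Injective fun i : Fin 6 => ζ ^ (a ^ (5 * (i : ℕ))) := by
    intro i j hij
    have h : 5 * (i : ℕ) ≡ 5 * j [MOD 6] := by
      apply hmod
      rw [hprim.eq_orderOf]
      exact (hprim.isOfFinOrder (by norm_num)).pow_eq_pow_iff_modEq.mp hij
    ext
    unfold Nat.ModEq at h
    omega
  have hli : LinearIndependent ℂ fun i : Fin 6 => ((A : Module.End ℂ V) ^ (i : ℕ)) (w : V) :=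
    Module.End.eigenvectors_linearIndependent' (B : Module.End ℂ V) _ hinj _ fun i =>
      ⟨Module.End.mem_eigenspace_iff.mpr
        (Module.End.apply_pow_eigenvector_of_conj_pow (m := 6) (by norm_num) hAB hB9 ha6 hv i),
        hpow0 i⟩
  have hspan := hli.span_eq_top_of_card_eq_finrank' (by simp [hdim])
  rw [eq_top_iff, ← hspan, Submodule.span_le]
  rintro _ ⟨i, rfl⟩
  exact hpowW i
end

section
/- Let k be an algebraically closed field and let n ≥ 2 be an integer not divisible by the characteristic of k. Let f ∈ k[X] be a nonconstant polynomial, write f = c·∏_{α ∈ S}(X − α)^{a_α} where S ⊆ k is the (finite, nonempty) set of roots of f, c ∈ kˣ, and a_α ≥ 1 is the multiplicity of the root α. If gcd(n, a_α : α ∈ S) = 1, then the polynomial Y^n − f(X) is irreducible in the polynomial ring k[X][Y]. -/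
open Polynomial

/-- If `g` is a monic divisor of `X ^ n - C f` of degree `d`, then the product of its roots,
`(-1) ^ d * g.coeff 0`, has `n`-th power `f ^ d`. -/
theorem Polynomial.Monic.neg_one_pow_mul_coeff_zero_pow {R : Type*} [CommRing R] [IsDomain R]
    {g : R[X]} (hg : g.Monic) {n : ℕ} {f : R} (hdvd : g ∣ X ^ n - C f) :
    ((-1) ^ g.natDegree * g.coeff 0) ^ n = f ^ g.natDegree := by
  let L := AlgebraicClosure (FractionRing R)
  have hinj : Function.Injective (algebraMap R L) := by
    rw [IsScalarTower.algebraMap_eq R (FractionRing R) L]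
    exact (algebraMap (FractionRing R) L).injective.comp (IsFractionRing.injective R _)
  have hsplit : (g.map (algebraMap R L)).Splits := IsAlgClosed.splits _
  have hcoeff := hsplit.coeff_zero_eq_prod_roots_of_monic (hg.map _)
  rw [coeff_map, hg.natDegree_map] at hcoeff
  have hcard := hsplit.natDegree_eq_card_roots
  rw [hg.natDegree_map] at hcard
  have hroot : ∀ y ∈ (g.map (algebraMap R L)).roots, y ^ n = algebraMap R L f := by
    intro y hy
    have := (isRoot_of_mem_roots hy).dvd (map_dvd (algebraMap R L) hdvd)
    simpa [IsRoot, sub_eq_zero] using this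
  apply hinj
  rw [map_pow, map_mul, map_pow, map_pow, map_neg, map_one, hcoeff, ← mul_assoc, ← mul_pow,
    neg_one_mul, neg_neg, one_pow, one_mul,
    ← Multiset.map_id' (g.map (algebraMap R L)).roots, ← Multiset.prod_map_pow,
    Multiset.map_congr rfl hroot, Multiset.map_const', Multiset.prod_replicate, hcard]

/-- Section 2.1 of the paper: if `f = c·∏_{α ∈ S}(X − α)^{a_α}` is a nonconstant
polynomial over an algebraically closed field `k`, `n ≥ 2` is prime to the
characteristic, and `gcd(n, a_α : α ∈ S) = 1`, then `Y^n − f(X)` is irreducible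
in `k[X][Y]`, i.e. the superelliptic curve `y^n = f(x)` is absolutely irreducible. -/
theorem superelliptic_irreducible {k : Type*} [Field k] [IsAlgClosed k]
    (n : ℕ) (hn : 2 ≤ n) (hchar : ¬ (ringChar k ∣ n))
    (f : Polynomial k) (hf : 0 < f.natDegree)
    (c : k) (hc : c ≠ 0) (S : Finset k) (hS : S.Nonempty) (a : k → ℕ)
    (ha : ∀ α ∈ S, 1 ≤ a α)
    (hroots : ∀ α : k, f.IsRoot α ↔ α ∈ S)
    (hfact : f = C c * ∏ α ∈ S, (X - C α) ^ a α)
    (hgcd : Nat.gcd n (S.gcd a) = 1) :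
    Irreducible ((X : Polynomial (Polynomial k)) ^ n - C f) := by
  classical
  have hmonic : ((X : k[X][X]) ^ n - C f).Monic := monic_X_pow_sub_C f (by omega)
  have hdeg : ((X : k[X][X]) ^ n - C f).natDegree = n := natDegree_X_pow_sub_C
  have hmult : ∀ α ∈ S, f.roots.count α = a α := by
    intro α hα
    have hne : ∏ β ∈ S, (X - C β) ^ a β ≠ 0 :=
      Finset.prod_ne_zero_iff.2 fun β _ => pow_ne_zero _ (X_sub_C_ne_zero β)
    rw [hfact, roots_C_mul _ hc, roots_prod _ _ hne, Multiset.count_bind]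
    simp only [roots_pow, roots_X_sub_C, Multiset.count_nsmul, Multiset.count_singleton]
    change ∑ β ∈ S, _ = _
    simp [hα]
  have key : ∀ g : k[X][X], g.Monic → g ∣ X ^ n - C f → n ∣ g.natDegree := by
    intro g hg hdvd
    have h := hg.neg_one_pow_mul_coeff_zero_pow hdvd
    have hd : ∀ α ∈ S, n ∣ g.natDegree * a α := by
      intro α hα
      have h' := congrArg (fun p : k[X] => p.roots.count α) h
      simp only [roots_pow, Multiset.count_nsmul, hmult α hα] at h'
      exact ⟨_, h'.symm⟩
    have hgd : n ∣ g.natDegree * S.gcd a := by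
      have := Finset.dvd_gcd hd
      rwa [Finset.gcd_mul_left, normalize_eq] at this
    exact Nat.Coprime.dvd_of_dvd_mul_right hgcd hgd
  rw [hmonic.irreducible_iff_natDegree]
  refine ⟨fun h => ?_, fun g h hg hh hgh => ?_⟩
  · rw [h, natDegree_one] at hdeg
    omega
  · have hsum := hg.natDegree_mul hh
    rw [hgh, hdeg] at hsum
    rcases Nat.eq_zero_or_pos g.natDegree with h0 | hpos
    · exact Or.inl h0
    · have := Nat.le_of_dvd hpos (key g hg ⟨h, hgh.symm⟩)
      omega
end
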